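/- Let n ≥ 2, let α ∈ ℂ with Re α > (1−n)/2, and let φ₀ : ℝⁿ → ℂ be a smooth function supported in the ball {|ξ| ≤ 2}. Then there exists a constant C ∈ (0,∞), depending only on n, α and φ₀, such that for every Schwartz function f on ℝⁿ and every x ∈ ℝⁿ, sup_{1 < t < 2} | ∫_{ℝⁿ} e^{2πi x·ξ} m̂_α(tξ) φ₀(ξ) f̂(ξ) dξ | ≤ C · M_{HL} f(x), where M_{HL} f(x) = sup_{r>0} |B(x,r)|^{−1} ∫_{B(x,r)} |f(y)| dy is the Hardy–Littlewood maximal function. (This is the low-frequency estimate of Step 1 of the proof of the main theorem, which rests on the smoothness of m̂_α near the origin.) -/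

import Mathlib

open MeasureTheory Filter Metric
open scoped ENNReal RealInnerProductSpace Topology

/-- The Bessel function `J_ν(r)` of complex order `ν` (with `Re ν > -1/2`), given by
Schläfli's integral representation. -/
noncomputable def besselJ (ν : ℂ) (r : ℝ) : ℂ :=
  (1 / (2 * (Real.pi : ℂ))) *
      (∫ θ in (-Real.pi)..Real.pi,
        Complex.exp (Complex.I * ((r * Real.sin θ : ℝ) : ℂ) - Complex.I * ν * (θ : ℂ))) -
    (Complex.sin (ν * (Real.pi : ℂ)) / (Real.pi : ℂ)) *
      (∫ s in Set.Ioi (0 : ℝ), Complex.exp (-(((r * Real.sinh s : ℝ) : ℂ) + ν * (s : ℂ))))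

/-- The Fourier transform `m̂_α(ξ) = π^{1-α} |ξ|^{-n/2-α+1} J_{n/2+α-1}(2π|ξ|)`. -/
noncomputable def mhat (n : ℕ) (α : ℂ) (ξ : EuclideanSpace ℝ (Fin n)) : ℂ :=
  (Real.pi : ℂ) ^ ((1 : ℂ) - α) * ((‖ξ‖ : ℝ) : ℂ) ^ (-(n : ℂ) / 2 - α + 1) *
    besselJ ((n : ℂ) / 2 + α - 1) (2 * Real.pi * ‖ξ‖)

/-- The Fourier transform `f̂(ξ) = ∫ f(x) e^{-2πi x·ξ} dx`. -/
noncomputable def fourierT {n : ℕ} (f : EuclideanSpace ℝ (Fin n) → ℂ)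
    (ξ : EuclideanSpace ℝ (Fin n)) : ℂ :=
  ∫ x, Complex.exp (((-(2 * Real.pi * ⟪x, ξ⟫) : ℝ) : ℂ) * Complex.I) * f x


/-- The integrand `exp (e^w - z e^{-w} - ν w)` of the rescaled Schläfli integral, in the
logarithmic variable `w`. -/
noncomputable def schlafliIntegrand (ν z w : ℂ) : ℂ :=
  Complex.exp (Complex.exp w - z * Complex.exp (-w) - ν * w)

/-- The rescaled Schläfli integral over the contour that comes from `+∞ - iπ`, crosses the strip
along `Re w = b` and returns to `+∞ + iπ`. -/
noncomputable def schlafliContour (ν z : ℂ) (b : ℝ) : ℂ :=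
  (1 / (2 * (Real.pi : ℂ))) *
      (∫ θ in (-Real.pi)..Real.pi, schlafliIntegrand ν z (b + θ * Complex.I)) -
    (Complex.sin (ν * (Real.pi : ℂ)) / (Real.pi : ℂ)) *
      (∫ s in Set.Ioi b, Complex.exp (-Complex.exp s + z * Complex.exp (-s) - ν * s))

lemma integrableOn_schlafli_ray (ν z : ℂ) (b : ℝ) :
    IntegrableOn (fun s : ℝ => Complex.exp (-Complex.exp s + z * Complex.exp (-s) - ν * s))
      (Set.Ioi b) := by
  have hc : Continuous (fun s : ℝ =>
      Complex.exp (-Complex.exp s + z * Complex.exp (-s) - ν * s)) := by fun_prop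
  refine Integrable.mono' (g := fun s : ℝ =>
      ‖Complex.exp (-Complex.exp s + z * Complex.exp (-s) - ν * s)‖) ?_
    hc.aestronglyMeasurable (ae_of_all _ fun _ => le_rfl)
  refine integrable_of_isBigO_exp_neg one_pos hc.norm.continuousOn ?_
  refine Asymptotics.IsBigO.of_bound (Real.exp (‖z‖ + (|ν.re| + 1) ^ 2 / 2)) ?_
  filter_upwards [eventually_ge_atTop 0] with s hs
  rw [norm_norm, Complex.norm_exp, Real.norm_eq_abs, Real.abs_exp, ← Real.exp_add]
  refine Real.exp_le_exp.2 ?_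
  have h1 : (z * Complex.exp (-(s : ℂ))).re ≤ ‖z‖ := by
    refine (Complex.re_le_norm _).trans ?_
    rw [norm_mul, Complex.norm_exp]
    refine mul_le_of_le_one_right (norm_nonneg _) ?_
    simpa using hs
  have h2 : (Complex.exp (s : ℂ)).re = Real.exp s := Complex.exp_ofReal_re s
  have h3 := Real.quadratic_le_exp_of_nonneg hs
  have h4 : -(ν.re * s) ≤ |ν.re| * s := by
    rw [← neg_mul]; exact mul_le_mul_of_nonneg_right (neg_le_abs _) hs
  simp only [Complex.sub_re, Complex.add_re, Complex.neg_re, h2, Complex.re_mul_ofReal]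
  nlinarith [sq_nonneg (s - (|ν.re| + 1))]

lemma schlafliIntegrand_add_pi_mul_I (ν z s : ℂ) :
    schlafliIntegrand ν z (s + Real.pi * Complex.I) =
      Complex.exp (-(ν * Real.pi * Complex.I)) *
        Complex.exp (-Complex.exp s + z * Complex.exp (-s) - ν * s) := by
  rw [schlafliIntegrand, neg_add, Complex.exp_add, Complex.exp_add, Complex.exp_neg (_ * _),
    Complex.exp_pi_mul_I, ← Complex.exp_add]
  congr 1; ring

lemma schlafliIntegrand_sub_pi_mul_I (ν z s : ℂ) :
    schlafliIntegrand ν z (s + (-Real.pi : ℝ) * Complex.I) =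
      Complex.exp (ν * Real.pi * Complex.I) *
        Complex.exp (-Complex.exp s + z * Complex.exp (-s) - ν * s) := by
  rw [schlafliIntegrand, neg_add, Complex.exp_add, Complex.exp_add, Complex.ofReal_neg, neg_mul,
    neg_neg, Complex.exp_neg (_ * _), Complex.exp_pi_mul_I, ← Complex.exp_add]
  congr 1; ring

/-- The rescaled Schläfli integral does not depend on the abscissa of the vertical segment. -/
lemma schlafliContour_eq (ν z : ℂ) (b : ℝ) : schlafliContour ν z b = schlafliContour ν z 0 := by
  have hd : Differentiable ℂ (schlafliIntegrand ν z) := by unfold schlafliIntegrand; fun_prop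
  have h := Complex.integral_boundary_rect_eq_zero_of_differentiableOn (schlafliIntegrand ν z)
    ((-Real.pi : ℝ) * Complex.I) (b + Real.pi * Complex.I) hd.differentiableOn
  simp only [Complex.add_re, Complex.add_im, Complex.re_ofReal_mul, Complex.im_ofReal_mul,
    Complex.I_re, Complex.I_im, Complex.ofReal_re, Complex.ofReal_im, mul_zero, mul_one, add_zero,
    zero_add, schlafliIntegrand_add_pi_mul_I, schlafliIntegrand_sub_pi_mul_I,
    intervalIntegral.integral_const_mul, smul_eq_mul] at h
  have hs := intervalIntegral.integral_interval_add_Ioi (integrableOn_schlafli_ray ν z 0)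
    (integrableOn_schlafli_ray ν z b)
  have hsin : Complex.exp (ν * Real.pi * Complex.I) - Complex.exp (-(ν * Real.pi * Complex.I)) =
      2 * Complex.I * Complex.sin (ν * Real.pi) := by
    rw [← neg_mul, Complex.exp_mul_I, Complex.exp_mul_I, Complex.cos_neg, Complex.sin_neg]; ring
  have hpi : (Real.pi : ℂ) ≠ 0 := by exact_mod_cast Real.pi_ne_zero
  rw [schlafliContour, schlafliContour, ← hs]
  rw [← sub_mul, hsin] at h
  generalize (∫ x in (0 : ℝ)..b, Complex.exp (-Complex.exp x + z * Complex.exp (-x) - ν * x)) = A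
    at h ⊢
  generalize Complex.sin (ν * Real.pi) = σ at h ⊢
  set P := ∫ θ in (-Real.pi)..Real.pi, schlafliIntegrand ν z (b + θ * Complex.I)
  set Q := ∫ θ in (-Real.pi)..Real.pi, schlafliIntegrand ν z ((0 : ℝ) + θ * Complex.I)
  generalize (∫ s in Set.Ioi b, Complex.exp (-Complex.exp s + z * Complex.exp (-s) - ν * s)) = R
  field_simp
  linear_combination (-Complex.I) * h + (P - Q + 2 * σ * A) * Complex.I_mul_I

/-- Schläfli's integral factors as `(r / 2) ^ ν` times an even entire function of `r`. -/
lemma besselJ_eq (ν : ℂ) {r : ℝ} (hr : 0 < r) :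
    besselJ ν r = ((r / 2 : ℝ) : ℂ) ^ ν * schlafliContour ν ((r / 2 : ℝ) ^ 2 : ℂ) 0 := by
  have hr2 : 0 < r / 2 := by positivity
  have hr2' : ((r / 2 : ℝ) : ℂ) ≠ 0 := by exact_mod_cast hr2.ne'
  set a : ℝ := Real.log (r / 2) with ha
  have hea : Complex.exp a = ((r / 2 : ℝ) : ℂ) := by
    rw [← Complex.ofReal_exp, ha, Real.exp_log hr2]
  have hpow : ((r / 2 : ℝ) : ℂ) ^ ν = Complex.exp (ν * a) := by
    rw [Complex.cpow_def_of_ne_zero hr2', ← Complex.ofReal_log hr2.le, mul_comm]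
  rw [← schlafliContour_eq ν _ a, schlafliContour, besselJ, mul_sub, mul_left_comm,
    mul_left_comm (_ ^ ν)]
  congr 2
  · rw [← intervalIntegral.integral_const_mul]
    refine intervalIntegral.integral_congr fun θ _ => ?_
    rw [hpow, schlafliIntegrand, ← Complex.exp_add, neg_add (a : ℂ), Complex.exp_add (a : ℂ),
      Complex.exp_add (-(a : ℂ)), Complex.exp_neg (a : ℂ), hea]
    congr 1
    have : (r : ℂ) * Complex.sin θ * Complex.I = (r / 2 : ℝ) * Complex.exp (θ * Complex.I) -
        (r / 2 : ℝ) * Complex.exp (-(θ * Complex.I)) := by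
      rw [Complex.sin, ← neg_mul]
      push_cast
      linear_combination
        (r / 2 * (Complex.exp (-θ * Complex.I) - Complex.exp (θ * Complex.I))) * Complex.I_mul_I
    push_cast at this hr2' ⊢
    field_simp at this ⊢
    linear_combination this
  · rw [← integral_const_mul]
    have h := (measurePreserving_add_right volume a).setIntegral_preimage_emb
      (measurableEmbedding_addRight a)
      (fun s : ℝ => ((r / 2 : ℝ) : ℂ) ^ ν * Complex.exp (-Complex.exp s +
        ((r / 2 : ℝ) ^ 2 : ℂ) * Complex.exp (-s) - ν * s)) (Set.Ioi a)
    rw [← h]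
    simp only [Set.preimage_add_const_Ioi, sub_self]
    refine integral_congr_ae (ae_of_all _ fun s => ?_)
    simp only
    rw [hpow, ← Complex.exp_add, Complex.ofReal_add, neg_add (s : ℂ), Complex.exp_add (s : ℂ),
      Complex.exp_add (-(s : ℂ)), Complex.exp_neg (a : ℂ), hea]
    congr 1
    have : (r : ℂ) * Complex.sinh s = (r / 2 : ℝ) * Complex.exp s -
        (r / 2 : ℝ) * Complex.exp (-s) := by
      rw [Complex.sinh]
      push_cast
      ring
    push_cast at this hr2' ⊢
    field_simp at this ⊢
    linear_combination -this

lemma differentiable_integral_mul_exp {X : Type*} [MeasurableSpace X] {μ : Measure X}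
    {k A : X → ℂ} (hk : Integrable k μ) (hA : AEStronglyMeasurable A μ)
    (hA1 : ∀ᵐ p ∂μ, ‖A p‖ ≤ 1) :
    Differentiable ℂ (fun z : ℂ => ∫ p, k p * Complex.exp (z * A p) ∂μ) := by
  intro z₀
  have hm : ∀ z : ℂ, AEStronglyMeasurable (fun p => k p * Complex.exp (z * A p)) μ := fun z =>
    hk.aestronglyMeasurable.mul
      (Complex.continuous_exp.comp_aestronglyMeasurable (hA.const_mul z))
  have hexp : ∀ {z a : ℂ}, ‖z - z₀‖ < 1 → ‖a‖ ≤ 1 →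
      ‖Complex.exp (z * a)‖ ≤ Real.exp (‖z₀‖ + 1) := fun {z a} hz ha => by
    refine (Complex.norm_exp_le_exp_norm _).trans (Real.exp_le_exp.2 ?_)
    rw [norm_mul]
    refine (mul_le_of_le_one_right (norm_nonneg _) ha).trans ?_
    linarith [norm_le_norm_add_norm_sub' z z₀]
  refine (hasDerivAt_integral_of_dominated_loc_of_deriv_le (s := Metric.ball z₀ 1)
    (F' := fun z p => k p * Complex.exp (z * A p) * A p)
    (bound := fun p => ‖k p‖ * Real.exp (‖z₀‖ + 1))
    (Metric.ball_mem_nhds z₀ one_pos) (Eventually.of_forall hm) ?_ ((hm z₀).mul hA) ?_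
    (hk.norm.mul_const _) ?_).2.differentiableAt
  · refine (hk.norm.mul_const (Real.exp (‖z₀‖ + 1))).mono' (hm z₀) ?_
    filter_upwards [hA1] with p hp
    rw [norm_mul]
    gcongr
    exact hexp (by simp) hp
  · filter_upwards [hA1] with p hp z hz
    rw [norm_mul, norm_mul]
    refine (mul_le_of_le_one_right (by positivity) hp).trans ?_
    gcongr
    exact hexp (mem_ball_iff_norm.1 hz) hp
  · refine ae_of_all _ fun p z _ => ?_
    have := (((hasDerivAt_id z).mul_const (A p)).cexp).const_mul (k p)
    simpa [mul_assoc] using this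

lemma differentiable_schlafliContour (ν : ℂ) :
    Differentiable ℂ (fun z => schlafliContour ν z 0) := by
  have h1 : Differentiable ℂ fun z : ℂ =>
      ∫ θ in (-Real.pi)..Real.pi, schlafliIntegrand ν z ((0 : ℝ) + θ * Complex.I) := by
    simp only [intervalIntegral.integral_of_le (neg_le_self Real.pi_pos.le)]
    have hk : Continuous fun θ : ℝ => schlafliIntegrand ν 0 ((0 : ℝ) + θ * Complex.I) := by
      unfold schlafliIntegrand; fun_prop
    have hA : Continuous fun θ : ℝ => -Complex.exp ((-θ : ℝ) * Complex.I) := by fun_prop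
    convert differentiable_integral_mul_exp (μ := volume.restrict (Set.Ioc (-Real.pi) Real.pi))
      (hk.integrableOn_Ioc) hA.aestronglyMeasurable
      (ae_of_all _ fun θ => by rw [norm_neg, Complex.norm_exp_ofReal_mul_I]) using 4 with z
    · rfl
    · simp only [schlafliIntegrand]
      rw [← Complex.exp_add]
      congr 1
      push_cast
      simp only [zero_add, neg_mul, sub_zero, zero_mul]
      ring
  have h2 : Differentiable ℂ fun z : ℂ =>
      ∫ s in Set.Ioi (0 : ℝ), Complex.exp (-Complex.exp s + z * Complex.exp (-s) - ν * s) := by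
    have hA : Continuous fun s : ℝ => Complex.exp (-s) := by fun_prop
    convert differentiable_integral_mul_exp (integrableOn_schlafli_ray ν 0 0)
      hA.aestronglyMeasurable ?_ using 4 with z s
    · rw [← Complex.exp_add]
      congr 1
      ring
    · filter_upwards [ae_restrict_mem measurableSet_Ioi] with s hs
      rw [Complex.norm_exp]
      simpa using (Set.mem_Ioi.1 hs).le
  unfold schlafliContour
  exact (h1.const_mul _).sub (h2.const_mul _)

/-- Away from the origin, `m̂_α(ξ)` is a constant multiple of an entire function of `|ξ|²`. -/
lemma mhat_eq (n : ℕ) (α : ℂ) {ξ : EuclideanSpace ℝ (Fin n)} (hξ : ξ ≠ 0) :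
    mhat n α ξ = (Real.pi : ℂ) ^ ((1 : ℂ) - α) * (Real.pi : ℂ) ^ ((n : ℂ) / 2 + α - 1) *
      schlafliContour ((n : ℂ) / 2 + α - 1) ((Real.pi ^ 2 * ‖ξ‖ ^ 2 : ℝ) : ℂ) 0 := by
  have hξ' : 0 < ‖ξ‖ := norm_pos_iff.2 hξ
  have h0 : ((‖ξ‖ : ℝ) : ℂ) ≠ 0 := by exact_mod_cast hξ'.ne'
  rw [mhat, besselJ_eq _ (by positivity), show 2 * Real.pi * ‖ξ‖ / 2 = Real.pi * ‖ξ‖ by ring,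
    Complex.ofReal_mul, Complex.mul_cpow_ofReal_nonneg Real.pi_pos.le hξ'.le,
    show -(n : ℂ) / 2 - α + 1 = -((n : ℂ) / 2 + α - 1) by ring, Complex.cpow_neg, mul_pow]
  have h1 : ((‖ξ‖ : ℝ) : ℂ) ^ ((n : ℂ) / 2 + α - 1) ≠ 0 := by simp [Complex.cpow_eq_zero_iff, h0]
  generalize (n : ℂ) / 2 + α - 1 = ν at h1 ⊢
  push_cast
  field_simp

/-- The smooth extension of `m̂_α` across the origin. -/
lemma exists_contDiff_eq_mhat (n : ℕ) (α : ℂ) :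
    ∃ H : EuclideanSpace ℝ (Fin n) → ℂ, ContDiff ℝ (⊤ : ℕ∞) H ∧ ∀ ξ, ξ ≠ 0 → mhat n α ξ = H ξ := by
  refine ⟨_, ?_, fun ξ hξ => mhat_eq n α hξ⟩
  have h := (differentiable_schlafliContour ((n : ℂ) / 2 + α - 1)).contDiff (n := (⊤ : ℕ∞))
  have h2 : ContDiff ℝ (⊤ : ℕ∞) fun ξ : EuclideanSpace ℝ (Fin n) =>
      ((Real.pi ^ 2 * ‖ξ‖ ^ 2 : ℝ) : ℂ) :=
    Complex.ofRealCLM.contDiff.comp (contDiff_const.mul (contDiff_norm_sq ℝ))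
  exact contDiff_const.mul ((h.restrict_scalars ℝ).comp h2)

lemma exists_dyadic_bound {V : Type*} [NormedAddCommGroup V] {K : V → ℂ} {B : ℝ} {d : ℕ}
    (h0 : ∀ y, ‖K y‖ ≤ B) (h1 : ∀ y, ‖y‖ ^ (d + 1) * ‖K y‖ ≤ B) (y : V) :
    ∃ k : ℕ, ‖y‖ < 2 ^ k ∧ ‖K y‖ ≤ B * 2 ^ (d + 1) * ((1 / 2) ^ k) ^ (d + 1) := by
  have hB : 0 ≤ B := (norm_nonneg _).trans (h0 0)
  rcases lt_or_ge ‖y‖ 1 with hy | hy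
  · refine ⟨0, by simpa using hy, ?_⟩
    simpa using (h0 y).trans (le_mul_of_one_le_right hB (one_le_pow₀ one_le_two))
  · obtain ⟨k, hk, hk'⟩ := exists_nat_pow_near hy one_lt_two
    refine ⟨k + 1, hk', ?_⟩
    have h2 : (2 ^ k : ℝ) ^ (d + 1) * ‖K y‖ ≤ B :=
      (mul_le_mul_of_nonneg_right (by gcongr) (norm_nonneg _)).trans (h1 y)
    have h3 : (2 : ℝ) ^ (d + 1) * ((1 / 2) ^ (k + 1)) ^ (d + 1) = ((2 ^ k : ℝ) ^ (d + 1))⁻¹ := by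
      have : (2 : ℝ) * (1 / 2) ^ (k + 1) = (2 ^ k)⁻¹ := by
        rw [pow_succ, one_div, inv_pow]; ring
      rw [← mul_pow, this, inv_pow]
    rw [mul_assoc, h3, ← div_eq_mul_inv, le_div_iff₀ (by positivity), mul_comm]
    exact h2

/-- Integration against a translate of a kernel of size `O((1 + |y|)^{-d-1})`, where `d` is the
dimension, is dominated by the Hardy–Littlewood maximal function. -/
lemma lintegral_mul_le_maximal {V : Type*} [NormedAddCommGroup V] [NormedSpace ℝ V]
    [FiniteDimensional ℝ V] [Nontrivial V] [MeasurableSpace V] [BorelSpace V] (μ : Measure V)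
    [μ.IsAddHaarMeasure] {f K : V → ℂ} (hf : Measurable f) {B : ℝ}
    (h0 : ∀ y, ‖K y‖ ≤ B) (h1 : ∀ y, ‖y‖ ^ (Module.finrank ℝ V + 1) * ‖K y‖ ≤ B) (x : V) :
    ∫⁻ y, ‖f y‖ₑ * ‖K (y - x)‖ₑ ∂μ ≤
      ENNReal.ofReal (B * 2 ^ (Module.finrank ℝ V + 2)) * μ (ball 0 1) *
        ⨆ (r : ℝ) (_ : 0 < r), (μ (ball x r))⁻¹ * ∫⁻ y in ball x r, ‖f y‖ₑ ∂μ := by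
  set d := Module.finrank ℝ V with hd
  set M := ⨆ (r : ℝ) (_ : 0 < r), (μ (ball x r))⁻¹ * ∫⁻ y in ball x r, ‖f y‖ₑ ∂μ with hM
  have hB : 0 ≤ B := (norm_nonneg _).trans (h0 0)
  set c : ℕ → ℝ := fun k => B * 2 ^ (d + 1) * ((1 / 2) ^ k) ^ (d + 1) with hc
  have hc0 : ∀ k, 0 ≤ c k := fun k => by positivity
  have hball : ∀ r : ℝ, 0 < r → ∫⁻ y in ball x r, ‖f y‖ₑ ∂μ ≤ μ (ball x r) * M := fun r hr => by
    have : (μ (ball x r))⁻¹ * ∫⁻ y in ball x r, ‖f y‖ₑ ∂μ ≤ M := by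
      rw [hM]
      exact le_iSup₂ (f := fun (r : ℝ) (_ : 0 < r) =>
        (μ (ball x r))⁻¹ * ∫⁻ y in ball x r, ‖f y‖ₑ ∂μ) r hr
    calc ∫⁻ y in ball x r, ‖f y‖ₑ ∂μ
        = μ (ball x r) * ((μ (ball x r))⁻¹ * ∫⁻ y in ball x r, ‖f y‖ₑ ∂μ) := by
          rw [← mul_assoc, ENNReal.mul_inv_cancel (measure_ball_pos μ x hr).ne'
            measure_ball_lt_top.ne, one_mul]
      _ ≤ _ := by gcongr
  have hpt : ∀ y, ‖f y‖ₑ * ‖K (y - x)‖ₑ ≤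
      ∑' k : ℕ, ENNReal.ofReal (c k) * (ball x (2 ^ k)).indicator (fun y => ‖f y‖ₑ) y := fun y => by
    obtain ⟨k, hk, hk'⟩ := exists_dyadic_bound h0 h1 (y - x)
    refine le_trans ?_ (ENNReal.le_tsum k)
    rw [Set.indicator_of_mem (mem_ball_iff_norm.2 hk), mul_comm, ← ofReal_norm (K (y - x))]
    gcongr
  have hterm : ∀ k : ℕ, ∫⁻ y, ENNReal.ofReal (c k) *
      (ball x (2 ^ k)).indicator (fun y => ‖f y‖ₑ) y ∂μ ≤
      ENNReal.ofReal (B * 2 ^ (d + 1) * (1 / 2) ^ k) * (μ (ball 0 1) * M) := fun k => by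
    rw [lintegral_const_mul _ (hf.enorm.indicator measurableSet_ball),
      lintegral_indicator measurableSet_ball]
    refine (mul_le_mul_right (hball _ (by positivity)) _).trans_eq ?_
    rw [Measure.addHaar_ball μ x (by positivity), ← mul_assoc, ← mul_assoc, ← mul_assoc,
      ← ENNReal.ofReal_mul (hc0 k), ← hd]
    congr 3
    have : ((1 / 2 : ℝ) ^ k) ^ d * (2 ^ k) ^ d = 1 := by
      rw [← mul_pow, ← mul_pow]; norm_num
    rw [hc]
    linear_combination (B * 2 ^ (d + 1) * (1 / 2) ^ k) * this
  calc ∫⁻ y, ‖f y‖ₑ * ‖K (y - x)‖ₑ ∂μ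
      ≤ ∑' k : ℕ, ∫⁻ y, ENNReal.ofReal (c k) *
          (ball x (2 ^ k)).indicator (fun y => ‖f y‖ₑ) y ∂μ := by
        rw [← lintegral_tsum fun k =>
          ((hf.enorm.indicator measurableSet_ball).const_mul _).aemeasurable]
        exact lintegral_mono hpt
    _ ≤ ∑' k : ℕ, ENNReal.ofReal (B * 2 ^ (d + 1) * (1 / 2) ^ k) * (μ (ball 0 1) * M) :=
        ENNReal.tsum_le_tsum hterm
    _ = ENNReal.ofReal (B * 2 ^ (d + 2)) * μ (ball 0 1) * M := by
        rw [ENNReal.tsum_mul_right, ← ENNReal.ofReal_tsum_of_nonneg (fun k => by positivity)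
          (summable_geometric_two.mul_left _), tsum_mul_left, tsum_geometric_two, mul_assoc B,
          ← pow_succ, mul_assoc]

lemma exists_norm_iteratedFDeriv_le_on_closedBall {V : Type*} [NormedAddCommGroup V]
    [NormedSpace ℝ V] [FiniteDimensional ℝ V] {h : V → ℂ} (hh : ContDiff ℝ (⊤ : ℕ∞) h) (R : ℝ)
    (i : ℕ) : ∃ M, 0 ≤ M ∧ ∀ v ∈ closedBall (0 : V) R, ‖iteratedFDeriv ℝ i h v‖ ≤ M := by
  have hc : Continuous (iteratedFDeriv ℝ i h) :=
    hh.continuous_iteratedFDeriv (by exact_mod_cast le_top)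
  obtain ⟨M, hM⟩ := (isCompact_closedBall (0 : V) R).exists_bound_of_continuousOn hc.continuousOn
  exact ⟨max M 0, le_max_right _ _, fun v hv => (hM v hv).trans (le_max_left _ _)⟩

lemma exists_norm_iteratedFDeriv_dilate_mul_le {V : Type*} [NormedAddCommGroup V]
    [NormedSpace ℝ V] [FiniteDimensional ℝ V] {H φ : V → ℂ} (hH : ContDiff ℝ (⊤ : ℕ∞) H)
    (hφ : ContDiff ℝ (⊤ : ℕ∞) φ) {R T : ℝ} (hT : 0 ≤ T) (j : ℕ) :
    ∃ C, 0 ≤ C ∧ ∀ t : ℝ, |t| ≤ T → ∀ v ∈ closedBall (0 : V) R,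
      ‖iteratedFDeriv ℝ j (fun ξ => H (t • ξ) * φ ξ) v‖ ≤ C := by
  choose M hM0 hM using exists_norm_iteratedFDeriv_le_on_closedBall hH (T * R)
  choose N hN0 hN using exists_norm_iteratedFDeriv_le_on_closedBall hφ R
  refine ⟨∑ i ∈ Finset.range (j + 1), (j.choose i : ℝ) * (T ^ i * M i) * N (j - i),
    Finset.sum_nonneg fun i _ => by have := hM0 i; have := hN0 (j - i); positivity,
    fun t ht v hv => ?_⟩
  have hHt : ContDiff ℝ (⊤ : ℕ∞) fun ξ => H (t • ξ) := hH.comp (contDiff_id.const_smul t)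
  refine (norm_iteratedFDeriv_mul_le hHt hφ v (by exact_mod_cast le_top)).trans ?_
  refine Finset.sum_le_sum fun i _ => ?_
  have htv : t • v ∈ closedBall (0 : V) (T * R) := by
    rw [mem_closedBall_zero_iff] at hv ⊢
    rw [norm_smul, Real.norm_eq_abs]
    gcongr
  have h1 : ‖iteratedFDeriv ℝ i (fun ξ => H (t • ξ)) v‖ ≤ T ^ i * M i := by
    rw [iteratedFDeriv_comp_const_smul t (hH.of_le (by exact_mod_cast le_top)), norm_smul,
      norm_pow, Real.norm_eq_abs]
    have := hM i _ htv
    gcongr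
  have h2 := hN (j - i) v hv
  have := hM0 i
  gcongr

/-- The Fourier transforms of the truncated dilates `ξ ↦ H(tξ) φ(ξ)` of a smooth function decay
rapidly, uniformly for `t` in a bounded set. -/
lemma exists_pow_mul_norm_fourier_dilate_mul_le {V : Type*} [NormedAddCommGroup V]
    [InnerProductSpace ℝ V] [FiniteDimensional ℝ V] [MeasurableSpace V] [BorelSpace V]
    {H φ : V → ℂ} (hH : ContDiff ℝ (⊤ : ℕ∞) H) (hφ : ContDiff ℝ (⊤ : ℕ∞) φ) {R T : ℝ} (hT : 0 ≤ T)
    (hsupp : tsupport φ ⊆ closedBall 0 R) (N : ℕ) :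
    ∃ B, ∀ t : ℝ, |t| ≤ T → ∀ w,
      ‖w‖ ^ N * ‖FourierTransform.fourier (fun ξ => H (t • ξ) * φ ξ) w‖ ≤ B := by
  choose C hC0 hC using exists_norm_iteratedFDeriv_dilate_mul_le (R := R) hH hφ hT
  refine ⟨2 ^ N * ∑ p ∈ Finset.range (0 + 1) ×ˢ Finset.range (N + 1),
    C p.2 * volume.real (closedBall (0 : V) R), fun t ht w => ?_⟩
  have hh : ContDiff ℝ (⊤ : ℕ∞) fun ξ => H (t • ξ) * φ ξ :=
    (hH.comp (contDiff_id.const_smul t)).mul hφ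
  have hs : (tsupport fun ξ => H (t • ξ) * φ ξ) ⊆ closedBall 0 R :=
    tsupport_mul_subset_right.trans hsupp
  have hcs : HasCompactSupport fun ξ => H (t • ξ) * φ ξ :=
    (isCompact_closedBall (0 : V) R).of_isClosed_subset (isClosed_tsupport _) hs
  have key := Real.pow_mul_norm_iteratedFDeriv_fourier_le (K := ⊤) (N := ⊤) hh
    (fun k n _ _ => ((continuous_norm.pow k).mul
      (hh.continuous_iteratedFDeriv (by exact_mod_cast le_top)).norm).integrable_of_hasCompactSupport
        ((hcs.iteratedFDeriv n).norm.mul_left)) (k := 0) (n := N) le_top le_top w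
  simp only [norm_iteratedFDeriv_zero, pow_zero, one_mul, Nat.cast_zero, mul_zero, zero_add] at key
  refine key.trans ?_
  gcongr with p hp
  have hp0 : p.1 = 0 := by
    simpa using (Finset.mem_product.1 hp).1
  simp only [hp0, pow_zero, one_mul]
  rw [← setIntegral_eq_integral_of_forall_compl_eq_zero (s := closedBall (0 : V) R) fun v hv => by
    rw [norm_eq_zero]
    by_contra hne
    exact hv (hs (support_iteratedFDeriv_subset _ hne))]
  refine (Real.le_norm_self _).trans (norm_setIntegral_le_of_norm_le_const
    measure_closedBall_lt_top fun v hv => ?_)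
  rw [norm_norm]
  exact hC _ t ht v hv

lemma fourierT_eq_fourier {n : ℕ} (f : EuclideanSpace ℝ (Fin n) → ℂ) :
    fourierT f = FourierTransform.fourier f := by
  ext ξ
  rw [fourierT, Real.fourier_eq']
  simp only [neg_mul, smul_eq_mul]

lemma fourier_modulate {V : Type*} [NormedAddCommGroup V]
    [InnerProductSpace ℝ V] [FiniteDimensional ℝ V] [MeasurableSpace V] [BorelSpace V]
    (h : V → ℂ) (x y : V) :
    FourierTransform.fourier
        (fun ξ => Complex.exp (((2 * Real.pi * ⟪x, ξ⟫ : ℝ) : ℂ) * Complex.I) * h ξ) y =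
      FourierTransform.fourier h (y - x) := by
  rw [Real.fourier_eq', Real.fourier_eq']
  refine integral_congr_ae (ae_of_all _ fun ξ => ?_)
  simp only [smul_eq_mul]
  rw [← mul_assoc, ← Complex.exp_add, inner_sub_right, real_inner_comm ξ x]
  congr 2
  push_cast
  ring

/-- A Fourier multiplier operator with integrable symbol is integration against the Fourier
transform of the symbol. -/
lemma integral_exp_mul_fourier {V : Type*} [NormedAddCommGroup V]
    [InnerProductSpace ℝ V] [FiniteDimensional ℝ V] [MeasurableSpace V] [BorelSpace V]
    {f h : V → ℂ} (hf : Integrable f) (hh : Integrable h) (x : V) :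
    ∫ ξ, Complex.exp (((2 * Real.pi * ⟪x, ξ⟫ : ℝ) : ℂ) * Complex.I) * h ξ *
        FourierTransform.fourier f ξ =
      ∫ y, f y * FourierTransform.fourier h (y - x) := by
  have hg : Integrable fun ξ =>
      Complex.exp (((2 * Real.pi * ⟪x, ξ⟫ : ℝ) : ℂ) * Complex.I) * h ξ := by
    refine hh.bdd_mul (c := 1) (Continuous.aestronglyMeasurable (by fun_prop)) ?_
    exact ae_of_all _ fun ξ => (Complex.norm_exp_ofReal_mul_I _).le
  have key := VectorFourier.integral_fourierIntegral_smul_eq_flip (L := innerₗ V)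
    (μ := volume) (ν := volume) Real.continuous_fourierChar continuous_inner hf hg
  rw [flip_innerₗ] at key
  simp only [← fourier_modulate, mul_comm _ (FourierTransform.fourier f _)]
  exact key

/-- The low-frequency estimate (Step 1 of the proof of the main theorem): for `Re α > (1-n)/2`
and a smooth `φ₀` supported in `{|ξ| ≤ 2}`, the truncated means `∫ e^{2πi x·ξ} m̂_α(tξ) φ₀(ξ)
f̂(ξ) dξ`, `1 < t < 2`, are dominated pointwise by the Hardy–Littlewood maximal function. -/
theorem low_frequency_pointwise_bound (n : ℕ) (hn : 2 ≤ n) (α : ℂ)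
    (hα : (1 - (n : ℝ)) / 2 < α.re)
    (φ₀ : EuclideanSpace ℝ (Fin n) → ℂ) (hφ : ContDiff ℝ (⊤ : ℕ∞) φ₀)
    (hsupp : tsupport φ₀ ⊆ Metric.closedBall 0 2) :
    ∃ C : ℝ, 0 < C ∧ ∀ f : SchwartzMap (EuclideanSpace ℝ (Fin n)) ℂ,
      ∀ x, ∀ t : ℝ, 1 < t → t < 2 →
        (‖∫ ξ, Complex.exp (((2 * Real.pi * ⟪x, ξ⟫ : ℝ) : ℂ) * Complex.I) * mhat n α (t • ξ) *
            φ₀ ξ * fourierT (fun y => f y) ξ‖₊ : ℝ≥0∞) ≤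
          ENNReal.ofReal C *
            ⨆ (r : ℝ) (_ : 0 < r),
              (volume (Metric.ball x r))⁻¹ * ∫⁻ y in Metric.ball x r, (‖f y‖₊ : ℝ≥0∞) := by
  obtain ⟨H, hH, hmH⟩ := exists_contDiff_eq_mhat n α
  have : NeZero n := ⟨by omega⟩
  obtain ⟨B₀, hB₀⟩ := exists_pow_mul_norm_fourier_dilate_mul_le hH hφ zero_le_two hsupp 0
  obtain ⟨B₁, hB₁⟩ := exists_pow_mul_norm_fourier_dilate_mul_le hH hφ zero_le_two hsupp
    (Module.finrank ℝ (EuclideanSpace ℝ (Fin n)) + 1)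
  set d := Module.finrank ℝ (EuclideanSpace ℝ (Fin n))
  set A : ℝ := max (max B₀ B₁) 0 * 2 ^ (d + 2) *
    volume.real (ball (0 : EuclideanSpace ℝ (Fin n)) 1) with hA
  have hA0 : 0 ≤ A := by positivity
  refine ⟨A + 1, by positivity, fun f x t ht1 ht2 => ?_⟩
  have htT : |t| ≤ 2 := abs_le.2 ⟨by linarith, ht2.le⟩
  have hh : Integrable fun ξ => H (t • ξ) * φ₀ ξ := by
    refine Continuous.integrable_of_hasCompactSupport ?_ ?_
    · exact (hH.continuous.comp (continuous_const_smul t)).mul hφ.continuous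
    · exact (isCompact_closedBall 0 2).of_isClosed_subset (isClosed_tsupport _)
        (tsupport_mul_subset_right.trans hsupp)
  have hint : ∫ ξ, Complex.exp (((2 * Real.pi * ⟪x, ξ⟫ : ℝ) : ℂ) * Complex.I) * mhat n α (t • ξ) *
      φ₀ ξ * fourierT (fun y => f y) ξ =
      ∫ y, f y * FourierTransform.fourier (fun ξ => H (t • ξ) * φ₀ ξ) (y - x) := by
    rw [← integral_exp_mul_fourier f.integrable hh x, fourierT_eq_fourier]
    refine integral_congr_ae ?_
    filter_upwards [Measure.ae_ne volume 0] with ξ hξ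
    rw [hmH _ (smul_ne_zero (by linarith) hξ), mul_assoc (Complex.exp _)]
  rw [hint]
  refine (enorm_integral_le_lintegral_enorm _).trans ?_
  simp only [enorm_mul]
  refine (lintegral_mul_le_maximal volume f.continuous.measurable (B := max (max B₀ B₁) 0)
    (fun y => ?_) (fun y => ?_) x).trans ?_
  · simpa using Or.inl (Or.inl (by simpa using hB₀ t htT y))
  · exact (hB₁ t htT y).trans ((le_max_right _ _).trans (le_max_left _ _))
  · refine mul_le_mul_left ?_ _
    rw [← ofReal_measureReal measure_ball_lt_top.ne, ← ENNReal.ofReal_mul (by positivity)]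
    exact ENNReal.ofReal_le_ofReal (by linarith)
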